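/- Quality of the SOS bounds on the joint spectral radius: let A₁,…,A_m ∈ ℝ^{n×n} with m ≥ 1 and let r ≥ 1 be an integer. Define ρ_{SOS,2r} as the infimum of all γ ≥ 0 such that there exists a homogeneous polynomial p ∈ ℝ[x₁,…,xₙ] of degree 2r for which p − (x₁² + ⋯ + xₙ²)^r is a sum of squares and, for every i ∈ {1,…,m}, the polynomial γ^{2r}·p(x) − p(Aᵢx) is a sum of squares. Then m^{−1/(2r)}·ρ_{SOS,2r} ≤ ρ ≤ ρ_{SOS,2r}, where ρ is the joint spectral radius of {A₁,…,A_m}; concretely, limsup_{k→∞} ( max_{σ∈{1,…,m}^k} ‖A_{σ₁}⋯A_{σ_k}‖ )^{1/k} ≤ ρ_{SOS,2r} and ρ_{SOS,2r} ≤ m^{1/(2r)}·liminf_{k→∞} ( max_{σ∈{1,…,m}^k} ‖A_{σ₁}⋯A_{σ_k}‖ )^{1/k}. -/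

import Mathlib

open MvPolynomial Filter

/-- The operator norm of a real `n × n` matrix induced by the Euclidean norm. -/
noncomputable def matOpNorm {n : ℕ} (M : Matrix (Fin n) (Fin n) ℝ) : ℝ :=
  ‖Matrix.toEuclideanCLM (𝕜 := ℝ) M‖

/-- A polynomial is a sum of squares. -/
def IsSOS {n : ℕ} (q : MvPolynomial (Fin n) ℝ) : Prop :=
  ∃ (t : ℕ) (h : Fin t → MvPolynomial (Fin n) ℝ), q = ∑ i, h i ^ 2

/-- The SOS upper bound `ρ_{SOS,2r}` on the joint spectral radius: the infimum of all `γ ≥ 0`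
such that some form `p` of degree `2r` satisfies `p − ‖x‖₂^{2r} ∈ Σ` and
`γ^{2r}·p − p(Aᵢx) ∈ Σ` for every `i`. -/
noncomputable def rhoSOS (n m r : ℕ) (A : Fin m → Matrix (Fin n) (Fin n) ℝ) : ℝ :=
  sInf {γ : ℝ | 0 ≤ γ ∧ ∃ p : MvPolynomial (Fin n) ℝ, p.IsHomogeneous (2 * r) ∧
    IsSOS (p - (∑ i, X i ^ 2) ^ r) ∧
    ∀ i : Fin m, IsSOS (C (γ ^ (2 * r)) * p -
      aeval (fun j : Fin n => ∑ l : Fin n, C (A i j l) * X l) p)}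

namespace IsSOS

variable {n : ℕ} {p q : MvPolynomial (Fin n) ℝ}

theorem sum_sq {ι : Type*} (s : Finset ι) (f : ι → MvPolynomial (Fin n) ℝ) :
    IsSOS (∑ i ∈ s, f i ^ 2) := by
  refine ⟨s.card, fun i => f (s.equivFin.symm i), ?_⟩
  rw [Equiv.sum_comp s.equivFin.symm (fun i => f i ^ 2), Finset.sum_coe_sort s (fun i => f i ^ 2)]

theorem zero : IsSOS (0 : MvPolynomial (Fin n) ℝ) := ⟨0, fun _ => 0, by simp⟩

theorem one : IsSOS (1 : MvPolynomial (Fin n) ℝ) := ⟨1, fun _ => 1, by simp⟩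

theorem add (hp : IsSOS p) (hq : IsSOS q) : IsSOS (p + q) := by
  obtain ⟨s, f, rfl⟩ := hp
  obtain ⟨t, g, rfl⟩ := hq
  have := sum_sq Finset.univ (Sum.elim f g)
  rwa [Fintype.sum_sum_type] at this

theorem mul (hp : IsSOS p) (hq : IsSOS q) : IsSOS (p * q) := by
  obtain ⟨s, f, rfl⟩ := hp
  obtain ⟨t, g, rfl⟩ := hq
  have := sum_sq Finset.univ (fun x : Fin s × Fin t => f x.1 * g x.2)
  rw [Fintype.sum_prod_type] at this
  simpa only [Finset.sum_mul_sum, mul_pow] using this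

theorem sum {ι : Type*} (s : Finset ι) (f : ι → MvPolynomial (Fin n) ℝ)
    (h : ∀ i ∈ s, IsSOS (f i)) : IsSOS (∑ i ∈ s, f i) :=
  Finset.sum_induction f IsSOS (fun _ _ => add) zero h

theorem pow (hp : IsSOS p) (k : ℕ) : IsSOS (p ^ k) := by
  induction k with
  | zero => simpa using one
  | succ k ih => simpa only [pow_succ] using ih.mul hp

theorem smul {c : ℝ} (hc : 0 ≤ c) (hp : IsSOS p) : IsSOS (c • p) := by
  obtain ⟨t, f, rfl⟩ := hp
  refine ⟨t, fun i => C (Real.sqrt c) * f i, ?_⟩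
  simp only [mul_pow, ← map_pow, Real.sq_sqrt hc, Finset.smul_sum, smul_eq_C_mul]

theorem map (φ : MvPolynomial (Fin n) ℝ →ₐ[ℝ] MvPolynomial (Fin n) ℝ) (hp : IsSOS p) :
    IsSOS (φ p) := by
  obtain ⟨t, f, rfl⟩ := hp
  exact ⟨t, fun i => φ (f i), by simp⟩

theorem eval_nonneg (hp : IsSOS p) (x : Fin n → ℝ) : 0 ≤ eval x p := by
  obtain ⟨t, f, rfl⟩ := hp
  simp only [map_sum, map_pow]
  positivity

theorem pow_sub_pow (hq : IsSOS q) (h : IsSOS (p - q)) (k : ℕ) : IsSOS (p ^ k - q ^ k) := by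
  have hp : IsSOS p := by simpa using h.add hq
  rw [← (Commute.all p q).mul_geom_sum₂ k]
  exact h.mul (sum _ _ fun i _ => (hp.pow i).mul (hq.pow _))

end IsSOS

section LinearSubstitution

variable {n : ℕ}

/-- The linear substitution `p(x) ↦ p(Mx)`. -/
noncomputable def linSubst (M : Matrix (Fin n) (Fin n) ℝ) :
    MvPolynomial (Fin n) ℝ →ₐ[ℝ] MvPolynomial (Fin n) ℝ :=
  aeval (fun j : Fin n => ∑ l : Fin n, C (M j l) * X l)

theorem eval_linSubst (M : Matrix (Fin n) (Fin n) ℝ) (p : MvPolynomial (Fin n) ℝ)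
    (x : Fin n → ℝ) : eval x (linSubst M p) = eval (M.mulVec x) p := by
  induction p using MvPolynomial.induction_on with
  | C a => simp [linSubst]
  | add p q hp hq => simp [hp, hq]
  | mul_X p i hp =>
    rw [map_mul, map_mul, hp]
    simp [linSubst, Matrix.mulVec, dotProduct]

theorem linSubst_linSubst (M N : Matrix (Fin n) (Fin n) ℝ) (p : MvPolynomial (Fin n) ℝ) :
    linSubst N (linSubst M p) = linSubst (M * N) p := by
  apply MvPolynomial.funext
  intro x
  simp only [eval_linSubst, Matrix.mulVec_mulVec]

theorem linSubst_one (p : MvPolynomial (Fin n) ℝ) : linSubst 1 p = p := by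
  apply MvPolynomial.funext
  intro x
  simp only [eval_linSubst, Matrix.one_mulVec]

theorem MvPolynomial.IsHomogeneous.linSubst {p : MvPolynomial (Fin n) ℝ} {d : ℕ}
    (hp : p.IsHomogeneous d) (M : Matrix (Fin n) (Fin n) ℝ) :
    (linSubst M p).IsHomogeneous d := by
  have := hp.aeval (fun j : Fin n => ∑ l : Fin n, C (M j l) * X l) (n := 1) fun j =>
    IsHomogeneous.sum _ _ _ fun l _ => isHomogeneous_C_mul_X _ _
  simpa [_root_.linSubst] using this

theorem sum_sq_eq_norm_sq (x : Fin n → ℝ) : ∑ i, x i ^ 2 = ‖WithLp.toLp 2 x‖ ^ 2 := by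
  simp [EuclideanSpace.norm_sq_eq]

theorem norm_mulVec_le (M : Matrix (Fin n) (Fin n) ℝ) (x : Fin n → ℝ) :
    ‖WithLp.toLp 2 (M.mulVec x)‖ ≤ matOpNorm M * ‖WithLp.toLp 2 x‖ := by
  simpa [matOpNorm] using (Matrix.toEuclideanCLM (𝕜 := ℝ) M).le_opNorm (WithLp.toLp 2 x)

open scoped MatrixOrder in
/-- If `‖B‖ ≤ s`, the form `s²‖x‖² − ‖Bx‖²` is a sum of squares. -/
theorem isSOS_sq_smul_sub_linSubst (B : Matrix (Fin n) (Fin n) ℝ) {s : ℝ}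
    (hB : matOpNorm B ≤ s) :
    IsSOS (s ^ 2 • ∑ i, X i ^ 2 - linSubst B (∑ i, X i ^ 2)) := by
  have key (x : Fin n → ℝ) (D : Matrix (Fin n) (Fin n) ℝ) :
      ∑ i, D.mulVec x i ^ 2 = dotProduct x ((D.transpose * D).mulVec x) := by
    rw [← Matrix.mulVec_mulVec, Matrix.dotProduct_mulVec, Matrix.vecMul_transpose]
    simp [dotProduct, sq]
  have hquad (x : Fin n → ℝ) :
      dotProduct x ((s ^ 2 • (1 : Matrix (Fin n) (Fin n) ℝ) - B.transpose * B).mulVec x) =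
        s ^ 2 * ∑ i, x i ^ 2 - ∑ i, B.mulVec x i ^ 2 := by
    rw [key, Matrix.sub_mulVec, Matrix.smul_mulVec, Matrix.one_mulVec, dotProduct_sub,
      dotProduct_smul, smul_eq_mul]
    simp [dotProduct, sq]
  have hpsd : (s ^ 2 • (1 : Matrix (Fin n) (Fin n) ℝ) - B.transpose * B).PosSemidef := by
    refine Matrix.PosSemidef.of_dotProduct_mulVec_nonneg ?_ fun x => ?_
    · simp [Matrix.IsHermitian]
    · have h1 := norm_mulVec_le B x
      have h2 : ‖WithLp.toLp 2 (B.mulVec x)‖ ^ 2 ≤ (s * ‖WithLp.toLp 2 x‖) ^ 2 := by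
        gcongr
        exact h1.trans (by gcongr)
      rw [mul_pow, ← sum_sq_eq_norm_sq, ← sum_sq_eq_norm_sq] at h2
      rw [star_trivial, hquad]
      exact sub_nonneg.mpr h2
  obtain ⟨D, hD⟩ := CStarAlgebra.nonneg_iff_eq_star_mul_self.mp hpsd.nonneg
  rw [Matrix.star_eq_conjTranspose] at hD
  have : s ^ 2 • ∑ i, X i ^ 2 - linSubst B (∑ i, X i ^ 2) = ∑ i, (linSubst D (X i)) ^ 2 := by
    apply MvPolynomial.funext
    intro x
    simp only [map_sub, smul_eval, map_sum, map_pow, eval_linSubst, eval_X]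
    rw [key x D, ← Matrix.conjTranspose_eq_transpose_of_trivial D, ← hD, hquad]
  rw [this]
  exact IsSOS.sum_sq _ _

theorem isSOS_pow_smul_sub_linSubst (B : Matrix (Fin n) (Fin n) ℝ) {s : ℝ}
    (hB : matOpNorm B ≤ s) (r : ℕ) :
    IsSOS (s ^ (2 * r) • (∑ i, X i ^ 2) ^ r - linSubst B ((∑ i, X i ^ 2) ^ r)) := by
  have := (IsSOS.map (linSubst B) (IsSOS.sum_sq Finset.univ (X (R := ℝ)))).pow_sub_pow
    (isSOS_sq_smul_sub_linSubst B hB) r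
  rwa [smul_pow, ← pow_mul, ← map_pow] at this

/-- A form of degree `d` is bounded by a multiple of `‖x‖^d`. -/
theorem MvPolynomial.IsHomogeneous.exists_eval_le {p : MvPolynomial (Fin n) ℝ} {d : ℕ}
    (hp : p.IsHomogeneous d) :
    ∃ K : ℝ, 1 ≤ K ∧ ∀ x : Fin n → ℝ, eval x p ≤ K * ‖WithLp.toLp 2 x‖ ^ d := by
  refine ⟨1 + ∑ u ∈ p.support, |coeff u p|, ?_, fun x => ?_⟩
  · have : 0 ≤ ∑ u ∈ p.support, |coeff u p| := by positivity
    linarith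
  · have h : eval x p ≤ ∑ u ∈ p.support, |coeff u p| * ‖WithLp.toLp 2 x‖ ^ d := by
      rw [eval_eq']
      refine Finset.sum_le_sum fun u hu => ?_
      have hd : ∑ i, u i = d := by
        have := hp (mem_support_iff.mp hu)
        rw [Finsupp.weight_apply, Finsupp.sum_fintype _ _ (by simp)] at this
        simpa using this
      refine (le_abs_self _).trans ?_
      rw [abs_mul, Finset.abs_prod, ← hd, ← Finset.prod_pow_eq_pow_sum]
      gcongr with i
      rw [abs_pow]
      gcongr
      simpa using PiLp.norm_apply_le (WithLp.toLp 2 x) i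
    rw [add_mul, Finset.sum_mul]
    have : 0 ≤ 1 * ‖WithLp.toLp 2 x‖ ^ d := by positivity
    linarith

end LinearSubstitution

section JointSpectralRadius

variable {n m r : ℕ} (A : Fin m → Matrix (Fin n) (Fin n) ℝ)

/-- The values `γ` admitting a feasible form `p` in the program defining `rhoSOS`. -/
def sosFeasible (r : ℕ) : Set ℝ :=
  {γ : ℝ | 0 ≤ γ ∧ ∃ p : MvPolynomial (Fin n) ℝ, p.IsHomogeneous (2 * r) ∧
    IsSOS (p - (∑ i, X i ^ 2) ^ r) ∧
    ∀ i : Fin m, IsSOS (C (γ ^ (2 * r)) * p - linSubst (A i) p)}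

theorem rhoSOS_eq_sInf : rhoSOS n m r A = sInf (sosFeasible A r) := rfl

/-- The largest norm of a product of `k` factors from `A`. -/
noncomputable def maxProdNorm (k : ℕ) : ℝ :=
  ⨆ σ : Fin k → Fin m, matOpNorm ((List.ofFn fun l => A (σ l)).prod)

theorem maxProdNorm_nonneg (k : ℕ) : 0 ≤ maxProdNorm A k :=
  Real.iSup_nonneg fun _ => norm_nonneg _

theorem le_maxProdNorm {k : ℕ} (σ : Fin k → Fin m) :
    matOpNorm ((List.ofFn fun l => A (σ l)).prod) ≤ maxProdNorm A k :=
  le_ciSup (f := fun σ : Fin k → Fin m => matOpNorm ((List.ofFn fun l => A (σ l)).prod))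
    (Set.finite_range _).bddAbove σ

variable {A}

theorem exists_maxProdNorm_le (hr : 1 ≤ r) {γ : ℝ} (h : γ ∈ sosFeasible A r) :
    ∃ K : ℝ, 1 ≤ K ∧ ∀ k : ℕ, maxProdNorm A k ≤ γ ^ k * K := by
  obtain ⟨hγ, p, hp, hlow, hdec⟩ := h
  obtain ⟨K, hK, hup⟩ := hp.exists_eval_le
  refine ⟨K, hK, fun k => ?_⟩
  have hK0 : 0 ≤ K := zero_le_one.trans hK
  refine Real.iSup_le (fun σ => ?_) (by positivity)
  have hiter (l : List (Fin m)) (x : Fin n → ℝ) :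
      eval ((l.map A).prod.mulVec x) p ≤ γ ^ (2 * r * l.length) * eval x p := by
    induction l with
    | nil => simp
    | cons i l ih =>
      have h := (hdec i).eval_nonneg ((l.map A).prod.mulVec x)
      rw [map_sub, map_mul, eval_C, eval_linSubst, Matrix.mulVec_mulVec, sub_nonneg] at h
      rw [List.map_cons, List.prod_cons, List.length_cons, mul_add, mul_one, add_comm, pow_add,
        mul_assoc]
      exact h.trans (by gcongr)
  refine ContinuousLinearMap.opNorm_le_bound _ (by positivity) fun x => ?_
  have h1 := hiter (List.ofFn σ) x
  rw [List.map_ofFn, List.length_ofFn] at h1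
  set M := (List.ofFn (A ∘ σ)).prod
  have h2 := hlow.eval_nonneg (M.mulVec x)
  simp only [map_sub, map_pow, map_sum, eval_X, sum_sq_eq_norm_sq, ← pow_mul, sub_nonneg] at h2
  have h3 : ‖WithLp.toLp 2 (M.mulVec x)‖ ^ (2 * r) ≤ (γ ^ k * K * ‖x‖) ^ (2 * r) :=
    calc _ ≤ γ ^ (2 * r * k) * (K * ‖x‖ ^ (2 * r)) := by
          refine (h2.trans h1).trans ?_
          gcongr
          exact hup x
      _ ≤ γ ^ (2 * r * k) * (K ^ (2 * r) * ‖x‖ ^ (2 * r)) := by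
          gcongr
          exact le_self_pow₀ hK (by omega)
      _ = _ := by ring
  exact le_of_pow_le_pow_left₀ (by omega) (by positivity) h3

theorem exists_tendsto_forall_rpow_le (hr : 1 ≤ r) {γ : ℝ} (h : γ ∈ sosFeasible A r) :
    ∃ u : ℕ → ℝ, Tendsto u atTop (nhds γ) ∧
      ∀ᶠ k in atTop, maxProdNorm A k ^ ((1 : ℝ) / k) ≤ u k := by
  obtain ⟨K, hK, hle⟩ := exists_maxProdNorm_le hr h
  refine ⟨fun k => γ * K ^ ((1 : ℝ) / k), ?_, ?_⟩
  · have := (tendsto_const_nhds (x := K)).rpow (tendsto_one_div_atTop_nhds_zero_nat (𝕜 := ℝ))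
      (Or.inl (by positivity))
    simpa using this.const_mul γ
  · filter_upwards [eventually_ge_atTop 1] with k hk
    calc _ ≤ (γ ^ k * K) ^ ((1 : ℝ) / k) :=
          Real.rpow_le_rpow (maxProdNorm_nonneg A k) (hle k) (by positivity)
      _ = _ := by
          rw [Real.mul_rpow (pow_nonneg h.1 k) (by positivity), one_div,
            Real.pow_rpow_inv_natCast h.1 (by omega)]

/-- The averaging operator `p ↦ c · ∑ᵢ p(Aᵢx)`. -/
noncomputable def substSum (A : Fin m → Matrix (Fin n) (Fin n) ℝ) (c : ℝ) :
    Module.End ℝ (MvPolynomial (Fin n) ℝ) :=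
  c • ∑ i, (linSubst (A i)).toLinearMap

theorem substSum_apply (c : ℝ) (p : MvPolynomial (Fin n) ℝ) :
    substSum A c p = c • ∑ i, linSubst (A i) p := by
  simp [substSum]

theorem substSum_pow_linSubst (c : ℝ) (k : ℕ) (M : Matrix (Fin n) (Fin n) ℝ)
    (p : MvPolynomial (Fin n) ℝ) :
    (substSum A c ^ k) (linSubst M p) =
      c ^ k • ∑ σ : Fin k → Fin m, linSubst (M * (List.ofFn fun l => A (σ l)).prod) p := by
  induction k generalizing M with
  | zero => simp
  | succ k ih =>
    rw [pow_succ, Module.End.mul_apply, substSum_apply, map_smul, map_sum]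
    simp only [linSubst_linSubst, ih]
    rw [← Finset.smul_sum, smul_smul, ← pow_succ',
      ← Equiv.sum_comp (Fin.consEquiv fun _ : Fin (k + 1) => Fin m), Fintype.sum_prod_type]
    simp [Fin.consEquiv, List.ofFn_succ, mul_assoc]

theorem substSum_pow_apply (c : ℝ) (k : ℕ) (p : MvPolynomial (Fin n) ℝ) :
    (substSum A c ^ k) p =
      c ^ k • ∑ σ : Fin k → Fin m, linSubst (List.ofFn fun l => A (σ l)).prod p := by
  simpa [linSubst_one] using substSum_pow_linSubst (A := A) c k 1 p

theorem IsSOS.substSum_pow {p : MvPolynomial (Fin n) ℝ} (hp : IsSOS p) {c : ℝ} (hc : 0 ≤ c)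
    (k : ℕ) : IsSOS ((substSum A c ^ k) p) := by
  rw [substSum_pow_apply]
  exact (IsSOS.sum _ _ fun σ _ => hp.map _).smul (by positivity)

theorem isSOS_sub_substSum_pow {c : ℝ} (hc : 0 ≤ c) {N : ℕ}
    (h : c ^ N * (m ^ N * maxProdNorm A N ^ (2 * r)) ≤ 1) :
    IsSOS ((∑ i, X i ^ 2) ^ r - (substSum A c ^ N) ((∑ i, X i ^ 2) ^ r)) := by
  set q : MvPolynomial (Fin n) ℝ := (∑ i, X i ^ 2) ^ r
  have hqs : IsSOS q := (IsSOS.sum_sq _ _).pow r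
  have h1 : IsSOS (c ^ N • ∑ σ : Fin N → Fin m,
      (maxProdNorm A N ^ (2 * r) • q - linSubst (List.ofFn fun l => A (σ l)).prod q)) :=
    (IsSOS.sum _ _ fun σ _ => isSOS_pow_smul_sub_linSubst _ (le_maxProdNorm A σ) r).smul
      (by positivity)
  have h2 := hqs.smul (sub_nonneg.mpr h)
  convert h1.add h2 using 1
  rw [substSum_pow_apply, Finset.sum_sub_distrib, Finset.sum_const, Finset.card_univ,
    Fintype.card_pi_const, Fintype.card_fin, ← Nat.cast_smul_eq_nsmul ℝ, Nat.cast_pow]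
  module

theorem mem_sosFeasible {γ : ℝ} (hγ : 0 < γ) {N : ℕ} (hN : N ≠ 0)
    (h : m ^ N * maxProdNorm A N ^ (2 * r) ≤ (γ ^ (2 * r)) ^ N) : γ ∈ sosFeasible A r := by
  set q : MvPolynomial (Fin n) ℝ := (∑ i, X i ^ 2) ^ r with hq
  have hqs : IsSOS q := (IsSOS.sum_sq _ _).pow r
  have hqh : q.IsHomogeneous (2 * r) :=
    (IsHomogeneous.sum _ _ _ fun i _ => isHomogeneous_X_pow i 2).pow r
  set g := γ ^ (2 * r) with hg
  have hg0 : 0 < g := by positivity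
  have hT : IsSOS (q - (substSum A g⁻¹ ^ N) q) := by
    refine isSOS_sub_substSum_pow (by positivity) ?_
    rw [inv_pow, inv_mul_le_one₀ (by positivity)]
    exact h
  have hs (k : ℕ) : IsSOS ((substSum A g⁻¹ ^ k) q) := hqs.substSum_pow (by positivity) k
  set p := ∑ k ∈ Finset.range N, (substSum A g⁻¹ ^ k) q with hp
  have hps : IsSOS p := IsSOS.sum _ _ fun k _ => hs k
  refine ⟨hγ.le, p, IsHomogeneous.sum _ _ _ fun k _ => ?_, ?_, fun i => ?_⟩
  · rw [substSum_pow_apply, smul_eq_C_mul]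
    simpa using (isHomogeneous_C (Fin n) ((g⁻¹) ^ k)).mul
      (IsHomogeneous.sum Finset.univ _ _ fun σ : Fin k → Fin m => fun _ => hqh.linSubst
        (List.ofFn fun l => A (σ l)).prod)
  · obtain ⟨N, rfl⟩ := Nat.exists_eq_succ_of_ne_zero hN
    rw [hp, Finset.sum_range_succ']
    simpa [← hq] using IsSOS.sum (Finset.range N) _ fun k _ => hs (k + 1)
  · have htel : substSum A g⁻¹ p = p - q + (substSum A g⁻¹ ^ N) q := by
      have h1 : substSum A g⁻¹ p = ∑ k ∈ Finset.range N, (substSum A g⁻¹ ^ (k + 1)) q := by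
        simp [hp, map_sum, pow_succ']
      have h2 := Finset.sum_range_succ' (fun k => (substSum A g⁻¹ ^ k) q) N
      rw [Finset.sum_range_succ, ← h1, ← hp] at h2
      simp only [pow_zero, Module.End.one_apply] at h2
      rw [sub_add_eq_add_sub, h2, add_sub_cancel_right]
    rw [substSum_apply, inv_smul_eq_iff₀ hg0.ne',
      ← Finset.add_sum_erase _ _ (Finset.mem_univ i)] at htel
    have h3 : IsSOS (g • (q - (substSum A g⁻¹ ^ N) q) +
        ∑ j ∈ Finset.univ.erase i, linSubst (A j) p) :=
      (hT.smul hg0.le).add (IsSOS.sum _ _ fun j _ => hps.map _)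
    convert h3 using 1
    rw [← smul_eq_C_mul, eq_sub_of_add_eq htel]
    module

theorem mem_sosFeasible_of_rpow_le (hr : 1 ≤ r) {γ : ℝ} (hγ : 0 < γ) {N : ℕ} (hN : N ≠ 0)
    (h : (m : ℝ) ^ ((1 : ℝ) / (2 * r)) * maxProdNorm A N ^ ((1 : ℝ) / N) ≤ γ) :
    γ ∈ sosFeasible A r := by
  have hs := maxProdNorm_nonneg A N
  refine mem_sosFeasible hγ hN ?_
  calc _ = (((m : ℝ) ^ ((1 : ℝ) / (2 * r)) * maxProdNorm A N ^ ((1 : ℝ) / N)) ^ (2 * r)) ^ N := by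
        have h1 : ((m : ℝ) ^ ((1 : ℝ) / (2 * r))) ^ (2 * r) = m := by
          have := Real.rpow_inv_natCast_pow (Nat.cast_nonneg (α := ℝ) m)
            (show 2 * r ≠ 0 by omega)
          simpa [one_div] using this
        have h2 : (maxProdNorm A N ^ ((1 : ℝ) / N)) ^ N = maxProdNorm A N := by
          rw [one_div, Real.rpow_inv_natCast_pow hs hN]
        rw [mul_pow, mul_pow, h1, pow_right_comm _ (2 * r) N, h2]
    _ ≤ _ := by gcongr

theorem sosFeasible_nonempty (hr : 1 ≤ r) : (sosFeasible A r).Nonempty := by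
  have := maxProdNorm_nonneg A 1
  exact ⟨_, mem_sosFeasible_of_rpow_le hr (add_pos_of_nonneg_of_pos (by positivity) one_pos)
    one_ne_zero (le_add_of_nonneg_right zero_le_one)⟩

end JointSpectralRadius

/-- **Quality of the SOS bounds on the joint spectral radius**:
`m^{-1/(2r)}·ρ_{SOS,2r} ≤ ρ ≤ ρ_{SOS,2r}`. -/
theorem sos_jsr_quality (n m r : ℕ) (hm : 1 ≤ m) (hr : 1 ≤ r)
    (A : Fin m → Matrix (Fin n) (Fin n) ℝ) :
    Filter.limsup (fun k : ℕ =>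
        (⨆ σ : Fin k → Fin m, matOpNorm ((List.ofFn fun l => A (σ l)).prod)) ^ ((1 : ℝ) / k))
      Filter.atTop ≤ rhoSOS n m r A ∧
    rhoSOS n m r A ≤ (m : ℝ) ^ ((1 : ℝ) / (2 * r)) *
      Filter.liminf (fun k : ℕ =>
        (⨆ σ : Fin k → Fin m, matOpNorm ((List.ofFn fun l => A (σ l)).prod)) ^ ((1 : ℝ) / k))
      Filter.atTop := by

  change limsup (fun k : ℕ => maxProdNorm A k ^ ((1 : ℝ) / k)) atTop ≤ rhoSOS n m r A ∧
    rhoSOS n m r A ≤ (m : ℝ) ^ ((1 : ℝ) / (2 * r)) *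
      liminf (fun k : ℕ => maxProdNorm A k ^ ((1 : ℝ) / k)) atTop
  have hnn (k : ℕ) : 0 ≤ maxProdNorm A k ^ ((1 : ℝ) / k) :=
    Real.rpow_nonneg (maxProdNorm_nonneg A k) _
  have hbelow : IsBoundedUnder (· ≥ ·) atTop fun k : ℕ => maxProdNorm A k ^ ((1 : ℝ) / k) :=
    isBoundedUnder_of ⟨0, hnn⟩
  have habove : IsBoundedUnder (· ≤ ·) atTop fun k : ℕ => maxProdNorm A k ^ ((1 : ℝ) / k) := by
    obtain ⟨γ, hγ⟩ := sosFeasible_nonempty (A := A) hr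
    obtain ⟨u, hu, hle⟩ := exists_tendsto_forall_rpow_le hr hγ
    exact hu.isBoundedUnder_le.mono_le hle
  rw [rhoSOS_eq_sInf]
  constructor
  · refine le_csInf (sosFeasible_nonempty hr) fun γ hγ => ?_
    obtain ⟨u, hu, hle⟩ := exists_tendsto_forall_rpow_le hr hγ
    rw [← hu.limsup_eq]
    exact limsup_le_limsup hle hbelow.isCoboundedUnder_le hu.isBoundedUnder_le
  · have hm0 : (0 : ℝ) < (m : ℝ) ^ ((1 : ℝ) / (2 * r)) := by positivity
    have hL : 0 ≤ liminf (fun k : ℕ => maxProdNorm A k ^ ((1 : ℝ) / k)) atTop :=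
      le_liminf_of_le habove.isCoboundedUnder_ge (Eventually.of_forall hnn)
    refine le_of_forall_gt_imp_ge_of_dense fun γ hγ => ?_
    have hlt := (lt_div_iff₀' hm0).mpr hγ
    obtain ⟨N, hN, hN0⟩ := ((frequently_lt_of_liminf_lt habove.isCoboundedUnder_ge
      hlt).and_eventually (eventually_ge_atTop 1)).exists
    exact csInf_le ⟨0, fun _ h => h.1⟩ (mem_sosFeasible_of_rpow_le hr
      ((mul_nonneg hm0.le hL).trans_lt hγ) (by omega) ((lt_div_iff₀' hm0).mp hN).le)
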